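/- Let n ≥ 1, N = 2n+2, 0 < α < 1, and let φ(r) = r^α. Then there is a constant C > 0, depending only on n, α and R*, such that for every f ∈ L¹(ℂ^n × ℝ), every j ∈ ℤ and every t ≠ 0, the Heisenberg convolution f * F_j^φ(t,·), defined by (f * F_j^φ(t,·))(w) = ∫_{ℂ^n×ℝ} f(w·v^{-1}) F_j^φ(t,v) dv with group law (z,s)·(z',s') = (z+z', s+s'+2 Im(z·z̄')) and (z,s)^{-1} = (-z,-s), satisfies sup_w |(f * F_j^φ(t,·))(w)| ≤ C |t|^{−1/2} 2^{j(N−α)} ‖f‖_{L¹}. -/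

import Mathlib

open MeasureTheory

/-- Squared Euclidean norm of `z ∈ ℂⁿ`. -/
noncomputable def hnormSq {n : ℕ} (z : Fin n → ℂ) : ℝ := ∑ j, Complex.normSq (z j)

/-- Laguerre polynomial of type `d` and degree `m`. -/
noncomputable def laguerreL (d m : ℕ) (t : ℝ) : ℝ :=
  ∑ k ∈ Finset.range (m + 1),
    (-1 : ℝ) ^ k * (Nat.choose (m + d) (m - k)) * t ^ k / (Nat.factorial k)

/-- The `m`-th term of the series defining the kernel `F_j^φ(t,z,s)` of the
frequency-localized propagator `e^{itφ(𝓛)}φ_j` on the Heisenberg group. -/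
noncomputable def Fterm (n : ℕ) (R φ : ℝ → ℝ) (j : ℤ) (t : ℝ)
    (z : Fin n → ℂ) (s : ℝ) (m : ℕ) : ℂ :=
  ∫ lam : ℝ,
    Complex.exp (-(Complex.I * lam * s)) *
      Complex.exp (Complex.I * t * (φ (4 * (2 * (m : ℝ) + n) * |lam|) : ℝ)) *
      ((R ((2 : ℝ) ^ (-(2 : ℤ) * j) * (2 * (m : ℝ) + n) * |lam|) *
        laguerreL (n - 1) m (2 * |lam| * hnormSq z) *
        Real.exp (-(|lam| * hnormSq z)) * |lam| ^ n : ℝ) : ℂ)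

/-- The kernel `F_j^φ(t,z,s)` of the frequency-localized propagator `e^{itφ(𝓛)}φ_j`
on the Heisenberg group `Hⁿ`. -/
noncomputable def Fkernel (n : ℕ) (R φ : ℝ → ℝ) (j : ℤ) (t : ℝ)
    (z : Fin n → ℂ) (s : ℝ) : ℂ :=
  (((2 : ℝ) ^ (n - 1) / Real.pi ^ (n + 1) : ℝ) : ℂ) * ∑' m : ℕ, Fterm n R φ j t z s m

/-- The Hermitean product `z·z̄' = Σ z_j conj(z'_j)` on `ℂⁿ`. -/
noncomputable def hprod {n : ℕ} (z w : Fin n → ℂ) : ℂ := ∑ j, z j * (starRingEnd ℂ) (w j)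

/-- Heisenberg group law on `ℂⁿ × ℝ`. -/
noncomputable def hMul {n : ℕ} (w v : (Fin n → ℂ) × ℝ) : (Fin n → ℂ) × ℝ :=
  (w.1 + v.1, w.2 + v.2 + 2 * (hprod w.1 v.1).im)

/-- Heisenberg group inverse. -/
noncomputable def hInv {n : ℕ} (v : (Fin n → ℂ) × ℝ) : (Fin n → ℂ) × ℝ := (-v.1, -v.2)

lemma hmul_mp {n : ℕ} (w : (Fin n → ℂ) × ℝ) :
    MeasurePreserving (fun v : (Fin n → ℂ) × ℝ => hMul w (hInv v)) := by
  have h1 : MeasurePreserving (fun z : Fin n → ℂ => w.1 - z) :=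
    Measure.measurePreserving_sub_left volume w.1
  have hc : Continuous (fun p : (Fin n → ℂ) × ℝ => w.2 + -p.2 + 2 * (hprod w.1 (-p.1)).im) := by
    unfold hprod
    fun_prop
  have := h1.skew_product (μc := (volume : Measure ℝ)) (μd := (volume : Measure ℝ))
    (g := fun z s => w.2 + -s + 2 * (hprod w.1 (-z)).im) hc.measurable
    (Filter.Eventually.of_forall (fun z => by
      have h := Measure.measurePreserving_sub_left (volume : Measure ℝ) (w.2 + 2 * (hprod w.1 (-z)).im)
      have e : (fun s : ℝ => w.2 + -s + 2 * (hprod w.1 (-z)).im)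
          = fun s => (w.2 + 2 * (hprod w.1 (-z)).im) - s := by
        funext s; ring
      rw [e]; exact h.map_eq))
  have e : (fun v : (Fin n → ℂ) × ℝ => hMul w (hInv v)) =
    fun p => (w.1 - p.1, w.2 + -p.2 + 2 * (hprod w.1 (-p.1)).im) := by
    funext v
    simp [hMul, hInv, sub_eq_add_neg]
  rw [e]; exact this

lemma conv_bound {n : ℕ} (f F : (Fin n → ℂ) × ℝ → ℂ) (hf : Integrable f) (B : ℝ)
    (hF : ∀ v, ‖F v‖ ≤ B) (w : (Fin n → ℂ) × ℝ) :
    ‖∫ v, f (hMul w (hInv v)) * F v‖ ≤ B * ∫ v, ‖f v‖ := by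
  have hmp := hmul_mp w
  have hi : Integrable (fun v => f (hMul w (hInv v))) :=
    (hmp.integrable_comp hf.1).2 hf
  have he : ∫ v, ‖f (hMul w (hInv v))‖ = ∫ v, ‖f v‖ := by
    have h := integral_map (μ := volume) (φ := fun v => hMul w (hInv v)) hmp.measurable.aemeasurable
      (f := fun v => ‖f v‖) (by rw [hmp.map_eq]; exact hf.norm.1)
    rw [hmp.map_eq] at h
    exact h.symm
  rw [← he, ← integral_const_mul]
  refine norm_integral_le_of_norm_le (hi.norm.const_mul B) (Filter.Eventually.of_forall fun v => ?_)
  rw [norm_mul, mul_comm]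
  exact mul_le_mul_of_nonneg_right (hF v) (norm_nonneg _)

lemma vdc1 (h h' h'' : ℝ → ℝ) (u v δ : ℝ) (huv : u ≤ v) (hδ : 0 < δ)
    (H1 : ∀ x ∈ Set.Icc u v, HasDerivAt h (h' x) x)
    (H2 : ∀ x ∈ Set.Icc u v, HasDerivAt h' (h'' x) x)
    (Hc : ContinuousOn h'' (Set.Icc u v))
    (Hp : ∀ x ∈ Set.Icc u v, 0 ≤ h'' x) (Hd : ∀ x ∈ Set.Icc u v, δ ≤ |h' x|) :
    ‖∫ x in u..v, Complex.exp (Complex.I * h x)‖ ≤ 4 / δ := by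
  have hu : Set.uIcc u v = Set.Icc u v := Set.uIcc_of_le huv
  have hne : ∀ x ∈ Set.Icc u v, h' x ≠ 0 := fun x hx h0 => by
    have := Hd x hx; rw [h0, abs_zero] at this; linarith
  have hc1 : ContinuousOn h (Set.Icc u v) := fun x hx => (H1 x hx).continuousAt.continuousWithinAt
  have hc2 : ContinuousOn h' (Set.Icc u v) := fun x hx => (H2 x hx).continuousAt.continuousWithinAt
  -- derivative of inverse
  have D1 : ∀ x ∈ Set.Icc u v, HasDerivAt (fun x => (h' x)⁻¹) (-h'' x / h' x ^ 2) x :=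
    fun x hx => (H2 x hx).inv (hne x hx)
  have D1c : ∀ x ∈ Set.uIcc u v, HasDerivAt (fun x => (((h' x)⁻¹ : ℝ) : ℂ))
      ((-h'' x / h' x ^ 2 : ℝ) : ℂ) x := fun x hx => (D1 x (hu ▸ hx)).ofReal_comp
  have D2 : ∀ x ∈ Set.uIcc u v, HasDerivAt (fun x => -Complex.I * Complex.exp (Complex.I * h x))
      (h' x * Complex.exp (Complex.I * h x)) x := by
    intro x hx
    have := (((H1 x (hu ▸ hx)).ofReal_comp.const_mul Complex.I).cexp).const_mul (-Complex.I)
    refine this.congr_deriv ?_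
    linear_combination (-(h' x : ℂ) * Complex.exp (Complex.I * h x)) * Complex.I_sq
  have hcd : ContinuousOn (fun x => -h'' x / h' x ^ 2) (Set.Icc u v) :=
    Hc.neg.div (hc2.pow 2) (fun x hx => pow_ne_zero 2 (hne x hx))
  have I1 : IntervalIntegrable (fun x => -h'' x / h' x ^ 2) volume u v := by
    apply ContinuousOn.intervalIntegrable; rwa [hu]
  have I1c : IntervalIntegrable (fun x => ((-h'' x / h' x ^ 2 : ℝ) : ℂ)) volume u v := by
    apply ContinuousOn.intervalIntegrable; rw [hu]
    exact Complex.continuous_ofReal.comp_continuousOn hcd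
  have I2 : IntervalIntegrable (fun x => h' x * Complex.exp (Complex.I * h x)) volume u v := by
    apply ContinuousOn.intervalIntegrable; rw [hu]
    exact (Complex.continuous_ofReal.comp_continuousOn hc2).mul
      (Complex.continuous_exp.comp_continuousOn
        (continuousOn_const.mul (Complex.continuous_ofReal.comp_continuousOn hc1)))
  have key := intervalIntegral.integral_mul_deriv_eq_deriv_mul D1c D2 I1c I2
  have e1 : ∫ x in u..v, Complex.exp (Complex.I * h x)
      = ∫ x in u..v, (((h' x)⁻¹ : ℝ) : ℂ) * (h' x * Complex.exp (Complex.I * h x)) := by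
    apply intervalIntegral.integral_congr
    intro x hx
    have : (h' x : ℂ) ≠ 0 := by exact_mod_cast hne x (hu ▸ hx)
    simp only [Complex.ofReal_inv]
    field_simp
  have nE : ∀ x : ℝ, ‖-Complex.I * Complex.exp (Complex.I * h x)‖ = 1 := by
    intro x
    rw [norm_mul, mul_comm Complex.I (h x : ℂ), Complex.norm_exp_ofReal_mul_I]; simp
  have bd : ∀ x ∈ Set.Icc u v, |(h' x)⁻¹| ≤ 1 / δ := fun x hx => by
    rw [abs_inv, ← one_div]
    exact one_div_le_one_div_of_le hδ (Hd x hx)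
  have hmu : u ∈ Set.Icc u v := ⟨le_rfl, huv⟩
  have hmv : v ∈ Set.Icc u v := ⟨huv, le_rfl⟩
  have b3 : ‖∫ x in u..v, ((-h'' x / h' x ^ 2 : ℝ) : ℂ) * (-Complex.I * Complex.exp (Complex.I * h x))‖
      ≤ 2 / δ := by
    calc _ ≤ ∫ x in u..v, -(-h'' x / h' x ^ 2) := by
          apply intervalIntegral.norm_integral_le_of_norm_le huv _ I1.neg
          refine Filter.Eventually.of_forall fun x hx => ?_
          have hx' : x ∈ Set.Icc u v := ⟨hx.1.le, hx.2⟩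
          rw [norm_mul, nE, mul_one, Complex.norm_real, Real.norm_eq_abs, abs_of_nonpos]
          · exact le_rfl
          · have : 0 ≤ h'' x / h' x ^ 2 := div_nonneg (Hp x hx') (sq_nonneg _)
            rw [neg_div]; linarith
      _ = -((h' v)⁻¹ - (h' u)⁻¹) := by
          rw [intervalIntegral.integral_neg,
            intervalIntegral.integral_eq_sub_of_hasDerivAt (fun x hx => D1 x (hu ▸ hx)) I1]
      _ ≤ 2 / δ := by
          have h1 := abs_le.1 (bd u hmu)
          have h2 := abs_le.1 (bd v hmv)
          have : 2 / δ = 1 / δ + 1 / δ := by ring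
          linarith [h1.1, h1.2, h2.1, h2.2]
  rw [e1, key]
  have n1 : ‖(((h' v)⁻¹ : ℝ) : ℂ) * (-Complex.I * Complex.exp (Complex.I * h v))‖ ≤ 1 / δ := by
    rw [norm_mul, nE, mul_one, Complex.norm_real]; exact bd v hmv
  have n2 : ‖(((h' u)⁻¹ : ℝ) : ℂ) * (-Complex.I * Complex.exp (Complex.I * h u))‖ ≤ 1 / δ := by
    rw [norm_mul, nE, mul_one, Complex.norm_real]; exact bd u hmu
  refine (norm_sub_le _ _).trans ?_
  refine (add_le_add (norm_sub_le _ _) b3).trans ?_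
  have : 4 / δ = 1 / δ + 1 / δ + 2 / δ := by ring
  linarith

lemma vdc2 (h h' h'' : ℝ → ℝ) (u v lam : ℝ) (huv : u ≤ v) (hl : 0 < lam)
    (H1 : ∀ x ∈ Set.Icc u v, HasDerivAt h (h' x) x)
    (H2 : ∀ x ∈ Set.Icc u v, HasDerivAt h' (h'' x) x)
    (Hc : ContinuousOn h'' (Set.Icc u v))
    (Hp : ∀ x ∈ Set.Icc u v, lam ≤ h'' x) :
    ‖∫ x in u..v, Complex.exp (Complex.I * h x)‖ ≤ 10 / Real.sqrt lam := by
  have hc1 : ContinuousOn h (Set.Icc u v) := fun x hx => (H1 x hx).continuousAt.continuousWithinAt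
  have hc2 : ContinuousOn h' (Set.Icc u v) := fun x hx => (H2 x hx).continuousAt.continuousWithinAt
  have mono : MonotoneOn (fun x => h' x - lam * x) (Set.Icc u v) := by
    apply monotoneOn_of_hasDerivWithinAt_nonneg (f' := fun x => h'' x - lam) (convex_Icc u v)
    · exact hc2.sub (by fun_prop)
    · intro x hx
      have hx' := interior_subset hx
      have := (H2 x hx').sub ((hasDerivAt_id x).const_mul lam)
      simp only [mul_one] at this
      exact this.hasDerivWithinAt
    · intro x hx
      have := Hp x (interior_subset hx)
      simpa using this
  have hmu : u ∈ Set.Icc u v := ⟨le_rfl, huv⟩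
  have hmv : v ∈ Set.Icc u v := ⟨huv, le_rfl⟩
  obtain ⟨c, hc, hcl, hcr⟩ : ∃ c ∈ Set.Icc u v, (∀ x ∈ Set.Icc u v, x < c → h' x ≤ -(lam * (c - x)))
      ∧ (∀ x ∈ Set.Icc u v, c < x → lam * (x - c) ≤ h' x) := by
    rcases le_or_gt 0 (h' u) with h0 | h0
    · refine ⟨u, hmu, fun x hx hxu => absurd hx.1 (not_le.2 hxu), fun x hx hxu => ?_⟩
      have := mono hmu hx hxu.le
      simp only at this; linarith
    rcases le_or_gt (h' v) 0 with h1 | h1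
    · refine ⟨v, hmv, fun x hx hxu => ?_, fun x hx hxu => absurd hx.2 (not_le.2 hxu)⟩
      have := mono hx hmv hxu.le
      simp only at this; linarith
    obtain ⟨c, hc, hc0⟩ := intermediate_value_Icc huv hc2 ⟨h0.le, h1.le⟩
    refine ⟨c, hc, fun x hx hxu => ?_, fun x hx hxu => ?_⟩
    · have := mono hx hc hxu.le
      simp only at this; linarith
    · have := mono hc hx hxu.le
      simp only at this; linarith
  have hs : 0 < Real.sqrt lam := Real.sqrt_pos.2 hl
  have hss : Real.sqrt lam * Real.sqrt lam = lam := Real.mul_self_sqrt hl.le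
  set δ := 1 / Real.sqrt lam with hδ
  have hδ0 : 0 < δ := by positivity
  have hlδ : lam * δ = Real.sqrt lam := by
    rw [hδ]; nth_rewrite 1 [← hss]; field_simp
  set p := max u (c - δ) with hp
  set q := min v (c + δ) with hq
  have hup : u ≤ p := le_max_left _ _
  have hpc : p ≤ c := max_le hc.1 (by linarith)
  have hcq : c ≤ q := le_min hc.2 (by linarith)
  have hqv : q ≤ v := min_le_left _ _
  have hE : ContinuousOn (fun x => Complex.exp (Complex.I * h x)) (Set.Icc u v) :=
    Complex.continuous_exp.comp_continuousOn
        (continuousOn_const.mul (Complex.continuous_ofReal.comp_continuousOn hc1))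
  have hI : ∀ a b, u ≤ a → a ≤ b → b ≤ v →
      IntervalIntegrable (fun x => Complex.exp (Complex.I * h x)) volume a b := by
    intro a b ha hab hb
    apply ContinuousOn.intervalIntegrable
    rw [Set.uIcc_of_le hab]
    exact hE.mono (Set.Icc_subset_Icc ha hb)
  have split : ∫ x in u..v, Complex.exp (Complex.I * h x) =
      (∫ x in u..p, Complex.exp (Complex.I * h x)) + (∫ x in p..q, Complex.exp (Complex.I * h x))
      + ∫ x in q..v, Complex.exp (Complex.I * h x) := by
    rw [intervalIntegral.integral_add_adjacent_intervals, intervalIntegral.integral_add_adjacent_intervals]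
    · exact hI u q le_rfl (by linarith) hqv
    · exact hI q v (by linarith) hqv le_rfl
    · exact hI u p le_rfl hup (by linarith)
    · exact hI p q hup (by linarith) hqv
  have hmid : ‖∫ x in p..q, Complex.exp (Complex.I * h x)‖ ≤ 2 * δ := by
    have := intervalIntegral.norm_integral_le_of_norm_le_const (a := p) (b := q) (C := 1)
      (f := fun x => Complex.exp (Complex.I * h x)) (fun x _ => by
        rw [mul_comm Complex.I (h x : ℂ), Complex.norm_exp_ofReal_mul_I])
    refine this.trans ?_
    rw [one_mul, abs_of_nonneg (by linarith)]
    have := le_max_right u (c - δ)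
    have := min_le_right v (c + δ)
    linarith
  have hleft : ‖∫ x in u..p, Complex.exp (Complex.I * h x)‖ ≤ 4 / Real.sqrt lam := by
    rcases eq_or_lt_of_le hup with he | hlt
    · rw [← he]; simp; positivity
    · have hpe : p = c - δ := by
        rcases max_choice u (c - δ) with h | h
        · rw [← hp] at h; linarith
        · exact h
      have hsub : Set.Icc u p ⊆ Set.Icc u v := Set.Icc_subset_Icc le_rfl (by linarith)
      refine vdc1 h h' h'' u p _ hup hs (fun x hx => H1 x (hsub hx)) (fun x hx => H2 x (hsub hx))
        (Hc.mono hsub) (fun x hx => hl.le.trans (Hp x (hsub hx))) (fun x hx => ?_)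
      have h1 := hcl x (hsub hx) (by linarith [hx.2])
      have h2 : lam * δ ≤ lam * (c - x) := mul_le_mul_of_nonneg_left (by linarith [hx.2]) hl.le
      have := neg_abs_le (h' x)
      linarith
  have hright : ‖∫ x in q..v, Complex.exp (Complex.I * h x)‖ ≤ 4 / Real.sqrt lam := by
    rcases eq_or_lt_of_le hqv with he | hlt
    · rw [he]; simp; positivity
    · have hpe : q = c + δ := by
        rcases min_choice v (c + δ) with h | h
        · rw [← hq] at h; linarith
        · exact h
      have hsub : Set.Icc q v ⊆ Set.Icc u v := Set.Icc_subset_Icc (by linarith) le_rfl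
      refine vdc1 h h' h'' q v _ hqv hs (fun x hx => H1 x (hsub hx)) (fun x hx => H2 x (hsub hx))
        (Hc.mono hsub) (fun x hx => hl.le.trans (Hp x (hsub hx))) (fun x hx => ?_)
      have h1 := hcr x (hsub hx) (by linarith [hx.1])
      have h2 : lam * δ ≤ lam * (x - c) := mul_le_mul_of_nonneg_left (by linarith [hx.1]) hl.le
      have := le_abs_self (h' x)
      linarith
  rw [split]
  refine (norm_add_le _ _).trans ((add_le_add ((norm_add_le _ _).trans (add_le_add hleft hmid)) hright).trans ?_)
  rw [hδ]
  apply le_of_eq; ring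

lemma vdc_amp (E : ℝ → ℂ) (a a' : ℝ → ℝ) (u v B : ℝ) (huv : u ≤ v)
    (hE : Continuous E) (ha : ∀ x ∈ Set.Icc u v, HasDerivAt a (a' x) x)
    (ha' : ContinuousOn a' (Set.Icc u v)) (hv : a v = 0)
    (hB : ∀ x ∈ Set.Icc u v, ‖∫ y in u..x, E y‖ ≤ B) :
    ‖∫ x in u..v, E x * (a x : ℂ)‖ ≤ B * ∫ x in u..v, |a' x| := by
  have hu : Set.uIcc u v = Set.Icc u v := Set.uIcc_of_le huv
  have D1 : ∀ x ∈ Set.uIcc u v, HasDerivAt (fun x => (a x : ℂ)) (a' x : ℂ) x :=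
    fun x hx => (ha x (hu ▸ hx)).ofReal_comp
  have D2 : ∀ x ∈ Set.uIcc u v, HasDerivAt (fun x => ∫ y in u..x, E y) (E x) x :=
    fun x hx => intervalIntegral.integral_hasDerivAt_right (hE.intervalIntegrable _ _)
      (hE.stronglyMeasurableAtFilter _ _) hE.continuousAt
  have I1 : IntervalIntegrable (fun x => (a' x : ℂ)) volume u v := by
    apply ContinuousOn.intervalIntegrable; rw [hu]
    exact Complex.continuous_ofReal.comp_continuousOn ha'
  have key := intervalIntegral.integral_mul_deriv_eq_deriv_mul D1 D2 I1 (hE.intervalIntegrable _ _)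
  have e : ∫ x in u..v, E x * (a x : ℂ) = ∫ x in u..v, (a x : ℂ) * E x := by
    simp only [mul_comm]
  rw [e, key, hv]
  simp only [Complex.ofReal_zero, zero_mul, intervalIntegral.integral_same, mul_zero, sub_zero, zero_sub, norm_neg]
  rw [← intervalIntegral.integral_const_mul]
  apply intervalIntegral.norm_integral_le_of_norm_le huv
  · refine Filter.Eventually.of_forall fun x hx => ?_
    rw [norm_mul, Complex.norm_real, Real.norm_eq_abs, mul_comm]
    exact mul_le_mul_of_nonneg_right (hB x ⟨hx.1.le, hx.2⟩) (abs_nonneg _)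
  · apply ContinuousOn.intervalIntegrable; rw [hu]
    exact continuousOn_const.mul ha'.abs

lemma vdc_phase (α : ℝ) (hα0 : 0 < α) (hα1 : α < 1) : ∃ K : ℝ, 0 < K ∧
    ∀ (T σ : ℝ), T ≠ 0 → ∀ x ∈ Set.Icc (1/4 : ℝ) 8,
    ‖∫ y in (1/4 : ℝ)..x, Complex.exp (Complex.I * ((T * y ^ α - σ * y : ℝ) : ℂ))‖
      ≤ K * |T| ^ (-(1/2) : ℝ) := by
  set κ := α * (1 - α) * (8:ℝ) ^ (α - 2) with hκ
  have h1α : 0 < 1 - α := by linarith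
  have hκ0 : 0 < κ := by positivity
  have main : ∀ (T σ : ℝ), T < 0 → ∀ x ∈ Set.Icc (1/4 : ℝ) 8,
    ‖∫ y in (1/4 : ℝ)..x, Complex.exp (Complex.I * ((T * y ^ α - σ * y : ℝ) : ℂ))‖
      ≤ 10 / Real.sqrt κ * |T| ^ (-(1/2) : ℝ) := by
    intro T σ hT x hx
    have hT' : 0 < |T| := abs_pos.2 hT.ne
    have h := vdc2 (fun y => T * y ^ α - σ * y) (fun y => T * (α * y ^ (α - 1)) - σ)
      (fun y => T * (α * ((α - 1) * y ^ (α - 2)))) (1/4) x (|T| * κ) hx.1 (by positivity)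
      (fun y hy => by
        have hy0 : y ≠ 0 := by linarith [hy.1]
        have := ((Real.hasDerivAt_rpow_const (p := α) (Or.inl hy0)).const_mul T).sub
          ((hasDerivAt_id y).const_mul σ)
        refine this.congr_deriv ?_
        simp)
      (fun y hy => by
        have hy0 : y ≠ 0 := by linarith [hy.1]
        have := (((Real.hasDerivAt_rpow_const (p := α - 1) (Or.inl hy0)).const_mul α).const_mul T).sub_const σ
        refine this.congr_deriv ?_
        have : α - 1 - 1 = α - 2 := by ring
        rw [this])
      (by
        have : ContinuousOn (fun y : ℝ => y ^ (α - 2)) (Set.Icc (1/4) x) := by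
          apply ContinuousOn.rpow_const continuousOn_id
          intro y hy; left; simp only [id]; linarith [hy.1]
        exact continuousOn_const.mul (continuousOn_const.mul (continuousOn_const.mul this)))
      (fun y hy => by
        have hy0 : 0 < y := by linarith [hy.1]
        have h8 : (8:ℝ) ^ (α - 2) ≤ y ^ (α - 2) :=
          Real.rpow_le_rpow_of_nonpos hy0 (hy.2.trans hx.2) (by linarith)
        rw [abs_of_neg hT, hκ]
        have : T * (α * ((α - 1) * y ^ (α - 2))) = -T * (α * (1 - α) * y ^ (α - 2)) := by ring
        rw [this]
        have hT2 : 0 ≤ -T := by linarith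
        gcongr)
    refine h.trans (le_of_eq ?_)
    rw [Real.sqrt_mul hT'.le, Real.rpow_neg hT'.le, ← Real.sqrt_eq_rpow]
    have : 0 < Real.sqrt |T| := Real.sqrt_pos.2 hT'
    have : 0 < Real.sqrt κ := Real.sqrt_pos.2 hκ0
    field_simp
  refine ⟨10 / Real.sqrt κ, by positivity, fun T σ hT x hx => ?_⟩
  rcases lt_or_gt_of_ne hT with h | h
  · exact main T σ h x hx
  · have := main (-T) (-σ) (by linarith) x hx
    rw [abs_neg] at this
    refine le_trans (le_of_eq ?_) this
    rw [intervalIntegral.integral_of_le hx.1, intervalIntegral.integral_of_le hx.1,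
      ← Complex.norm_conj, ← integral_conj]
    congr 2
    funext y
    rw [← Complex.exp_conj]
    congr 1
    simp only [map_mul, Complex.conj_I, Complex.conj_ofReal]
    push_cast
    ring

section LaguerrePart

open Polynomial in
noncomputable def LagP (m : ℕ) : ℝ[X] :=
  ∑ k ∈ Finset.range (m + 1), C ((-1 : ℝ) ^ k * (Nat.choose m k) / (Nat.factorial k)) * X ^ k

lemma LagP_eval (m : ℕ) (x : ℝ) : laguerreL 0 m x = (LagP m).eval x := by
  unfold laguerreL LagP
  rw [Polynomial.eval_finsetSum]
  apply Finset.sum_congr rfl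
  intro k hk
  have hk' : k ≤ m := by simpa [Nat.lt_succ_iff] using hk
  simp only [add_zero, Nat.choose_symm hk', Polynomial.eval_mul, Polynomial.eval_C, Polynomial.eval_pow, Polynomial.eval_X]
  ring

lemma LagP_coeff (m k : ℕ) : (LagP m).coeff k = (-1 : ℝ) ^ k * (Nat.choose m k) / (Nat.factorial k) := by
  unfold LagP
  simp only [Polynomial.finsetSum_coeff, Polynomial.coeff_C_mul_X_pow]
  rw [Finset.sum_ite_eq]
  split_ifs with h
  · rfl
  · have : m < k := by simpa using h
    simp [Nat.choose_eq_zero_of_lt this]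

open Polynomial

lemma LagP_deriv_succ (m : ℕ) : derivative (LagP (m+1)) = derivative (LagP m) - LagP m := by
  ext k
  simp only [coeff_derivative, coeff_sub, LagP_coeff]
  rw [Nat.choose_succ_succ, Nat.factorial_succ]
  have : (Nat.factorial k : ℝ) ≠ 0 := by positivity
  have h2 : (k : ℝ) + 1 ≠ 0 := by positivity
  push_cast
  field_simp
  ring

lemma LagP_deriv (m : ℕ) : derivative (LagP m) = - ∑ k ∈ Finset.range m, LagP k := by
  induction m with
  | zero => simp [LagP]
  | succ m ih => rw [LagP_deriv_succ, ih, Finset.sum_range_succ]; ring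

lemma LagP_ode (m : ℕ) : X * derivative (derivative (LagP m)) + (1 - X) * derivative (LagP m)
    + (m : ℝ[X]) * LagP m = 0 := by
  ext k
  have h := Nat.choose_succ_right_eq m k
  have hz : (Nat.choose m (k+1) : ℝ) * (k + 1) = Nat.choose m k * ((m:ℝ) - k) := by
    rcases le_or_gt k m with hk | hk
    · rw [← Nat.cast_sub hk]; exact_mod_cast h
    · simp [Nat.choose_eq_zero_of_lt hk, Nat.choose_eq_zero_of_lt (Nat.lt_succ_of_lt hk)]
  have e : X * derivative (derivative (LagP m)) + (1 - X) * derivative (LagP m) + (m : ℝ[X]) * LagP m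
    = X * derivative (derivative (LagP m)) + derivative (LagP m) - X * derivative (LagP m) + C (m:ℝ) * LagP m := by
    simp; ring
  rw [e]
  have hf : (Nat.factorial k : ℝ) ≠ 0 := by positivity
  have h2 : (k : ℝ) + 1 ≠ 0 := by positivity
  rcases k with _ | k
  · simp only [coeff_add, coeff_sub, coeff_X_mul_zero, coeff_derivative, coeff_C_mul, LagP_coeff]
    simp at hz ⊢
  · simp only [coeff_add, coeff_sub, coeff_X_mul, coeff_derivative, coeff_C_mul, LagP_coeff, coeff_zero]
    simp only [Nat.factorial_succ (k+1)]
    push_cast at hz h2 ⊢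
    have hc : ((m.choose (k+1+1) : ℕ) : ℝ) = m.choose (k+1) * (m - (k+1)) / (k+1+1) := by
      field_simp; linarith
    rw [hc]
    field_simp
    ring

lemma LagP_zero (m : ℕ) : (LagP m).eval 0 = 1 := by
  rw [← coeff_zero_eq_eval_zero, LagP_coeff]; simp

lemma pexp_int (p : ℝ[X]) (a : ℝ) (ha : 0 ≤ a) :
    IntegrableOn (fun x : ℝ => p.eval x * Real.exp (-x)) (Set.Ioi a) := by
  have : IntegrableOn (fun x : ℝ => p.eval x * Real.exp (-x)) (Set.Ioi 0) := by
    induction p using Polynomial.induction_on' with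
    | add p q hp hq =>
      simp only [eval_add, add_mul]; exact hp.add hq
    | monomial k c =>
      have := Real.GammaIntegral_convergent (s := k + 1) (by positivity)
      have h2 := this.const_mul c
      refine IntegrableOn.congr_fun h2 (fun x hx => ?_) measurableSet_Ioi
      simp only [eval_monomial, add_sub_cancel_right, Real.rpow_natCast]; ring
  exact this.mono_set (Set.Ioi_subset_Ioi ha)

lemma pexp_hasDeriv (p : ℝ[X]) (x : ℝ) : HasDerivAt (fun x : ℝ => p.eval x * Real.exp (-x))
    ((derivative p - p).eval x * Real.exp (-x)) x := by
  have := (p.hasDerivAt x).mul ((hasDerivAt_id x).neg.exp)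
  refine this.congr_deriv ?_
  simp; ring

lemma pexp_ftc (p : ℝ[X]) (a : ℝ) (ha : 0 ≤ a) :
    ∫ x in Set.Ioi a, (p - derivative p).eval x * Real.exp (-x) = p.eval a * Real.exp (-a) := by
  have h := integral_Ioi_of_hasDerivAt_of_tendsto' (a := a) (m := 0) (fun x _ => pexp_hasDeriv p x)
    (pexp_int _ a ha) (by
      have := Polynomial.tendsto_div_exp_atTop p
      simpa [div_eq_mul_inv, Real.exp_neg] using this)
  have e : ∀ x : ℝ, (p - derivative p).eval x * Real.exp (-x)
      = -((derivative p - p).eval x * Real.exp (-x)) := by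
    intro x; simp
    ring
  simp only [e]
  rw [integral_neg, h]; simp

noncomputable def Lam : ℝ[X] →ₗ[ℝ] ℝ where
  toFun p := ∫ x in Set.Ioi (0:ℝ), p.eval x * Real.exp (-x)
  map_add' p q := by
    simp only [eval_add, add_mul]
    exact integral_add (pexp_int p 0 le_rfl) (pexp_int q 0 le_rfl)
  map_smul' c p := by
    simp only [eval_smul, smul_eq_mul, mul_assoc, RingHom.id_apply]
    exact integral_const_mul _ _

lemma Lam_apply (p : ℝ[X]) : Lam p = ∫ x in Set.Ioi (0:ℝ), p.eval x * Real.exp (-x) := rfl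

lemma Lam_deriv (p : ℝ[X]) : Lam (p - derivative p) = p.eval 0 := by
  rw [Lam_apply, pexp_ftc p 0 le_rfl]; simp

lemma Lam_mono (p q : ℝ[X]) (h : ∀ x : ℝ, 0 < x → p.eval x ≤ q.eval x) : Lam p ≤ Lam q := by
  rw [Lam_apply, Lam_apply]
  refine setIntegral_mono_on (pexp_int p 0 le_rfl) (pexp_int q 0 le_rfl) measurableSet_Ioi
    (fun x hx => ?_)
  exact mul_le_mul_of_nonneg_right (h x hx) (Real.exp_pos _).le

lemma Lam_natmul (m : ℕ) (p : ℝ[X]) : Lam ((m : ℝ[X]) * p) = m * Lam p := by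
  have : (m : ℝ[X]) * p = (m : ℝ) • p := by rw [smul_eq_C_mul]; simp
  rw [this, map_smul, smul_eq_mul]

lemma LagP_orth (m k : ℕ) (hmk : m ≠ k) : Lam (LagP m * LagP k) = 0 := by
  have h := Lam_deriv (X * (derivative (LagP m) * LagP k - LagP m * derivative (LagP k)))
  have e : X * (derivative (LagP m) * LagP k - LagP m * derivative (LagP k))
      - derivative (X * (derivative (LagP m) * LagP k - LagP m * derivative (LagP k)))
      = (m : ℝ[X]) * (LagP m * LagP k) - (k : ℝ[X]) * (LagP m * LagP k) := by
    simp only [derivative_mul, derivative_sub, derivative_X]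
    linear_combination (-LagP k) * LagP_ode m + LagP m * LagP_ode k
  rw [e, map_sub, Lam_natmul, Lam_natmul, ← sub_mul] at h
  simp at h
  rcases h with h | h
  · exact absurd (by exact_mod_cast sub_eq_zero.1 h) hmk
  · exact h

lemma LagP_norm (m : ℕ) : Lam (LagP m * LagP m) = 1 := by
  have h := Lam_deriv (LagP m * LagP m)
  rw [map_sub] at h
  have h0 : Lam (derivative (LagP m * LagP m)) = 0 := by
    have : derivative (LagP m * LagP m) = - ∑ k ∈ Finset.range m, (LagP m * LagP k + LagP m * LagP k) := by
      rw [derivative_mul, LagP_deriv, Finset.sum_add_distrib, ← Finset.mul_sum]; ring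
    rw [this, map_neg, map_sum, Finset.sum_eq_zero, neg_zero]
    intro k hk
    rw [map_add, LagP_orth m k (Finset.mem_range.1 hk).ne']; simp
  rw [h0] at h
  simpa [LagP_zero] using h

lemma LagP_dnorm (m : ℕ) : Lam (derivative (LagP m) * derivative (LagP m)) = m := by
  rw [LagP_deriv, neg_mul_neg, Finset.sum_mul_sum, map_sum]
  have : ∀ i ∈ Finset.range m, Lam (∑ j ∈ Finset.range m, LagP i * LagP j) = 1 := by
    intro i hi
    rw [map_sum, Finset.sum_eq_single i, LagP_norm]
    · intro j _ hj; exact LagP_orth i j hj.symm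
    · intro h; exact absurd hi h
  rw [Finset.sum_congr rfl this]; simp

lemma LagP_xd (m : ℕ) : Lam (X * (derivative (LagP m) * derivative (LagP m))) = m := by
  have h := Lam_deriv (X * (LagP m * derivative (LagP m)))
  have e : X * (LagP m * derivative (LagP m)) - derivative (X * (LagP m * derivative (LagP m)))
      = (m : ℝ[X]) * (LagP m * LagP m) - X * (derivative (LagP m) * derivative (LagP m)) := by
    simp only [derivative_mul, derivative_X]
    linear_combination (-LagP m) * LagP_ode m
  rw [e, map_sub, Lam_natmul, LagP_norm] at h
  simp at h
  linarith

lemma LagP_x (m : ℕ) : Lam (X * (LagP m * LagP m)) ≤ 4 * m + 2 := by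
  have h := Lam_deriv (X * (LagP m * LagP m))
  have e : derivative (X * (LagP m * LagP m)) = LagP m * LagP m + (2:ℝ) • (X * (LagP m * derivative (LagP m))) := by
    simp only [derivative_mul, derivative_X, two_smul]; ring
  rw [map_sub, e, map_add, LagP_norm, map_smul] at h
  have h2 := Lam_mono ((2:ℝ) • (X * (LagP m * derivative (LagP m))))
    ((2:ℝ) • (X * (derivative (LagP m) * derivative (LagP m))) + (1/2 : ℝ) • (X * (LagP m * LagP m)))
    (fun x hx => by
      simp only [eval_smul, eval_mul, eval_X, eval_add, smul_eq_mul]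
      nlinarith [mul_nonneg hx.le (sq_nonneg (2 * (derivative (LagP m)).eval x - (LagP m).eval x))])
  rw [map_smul, map_add, map_smul, map_smul, LagP_xd] at h2
  simp at h h2
  linarith

/-- the Laguerre function -/
noncomputable def lagE (d m : ℕ) (x : ℝ) : ℝ := laguerreL d m x * Real.exp (-(x/2))

lemma lagE0_sup (m : ℕ) (x : ℝ) (hx : 0 ≤ x) : |lagE 0 m x| ≤ Real.sqrt (m + 2) := by
  apply Real.abs_le_sqrt
  have h := pexp_ftc (LagP m * LagP m) x hx
  have e : lagE 0 m x ^ 2 = (LagP m * LagP m).eval x * Real.exp (-x) := by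
    rw [lagE, LagP_eval, mul_pow, ← Real.exp_nat_mul]; simp
    ring_nf
  rw [e, ← h]
  set q : ℝ[X] := (2:ℝ) • (LagP m * LagP m) + derivative (LagP m) * derivative (LagP m) with hq
  have hL : Lam q = m + 2 := by
    rw [hq, map_add, map_smul, LagP_norm, LagP_dnorm]; simp; ring
  have hqn : ∀ y, 0 ≤ q.eval y := by
    intro y; rw [hq]; simp only [eval_smul, eval_mul, eval_add, smul_eq_mul]
    nlinarith [mul_self_nonneg ((LagP m).eval y), mul_self_nonneg ((derivative (LagP m)).eval y)]
  rw [← hL, Lam_apply]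
  calc _ ≤ ∫ y in Set.Ioi x, q.eval y * Real.exp (-y) := by
        refine setIntegral_mono_on (pexp_int _ x hx) (pexp_int q x hx) measurableSet_Ioi
          (fun y hy => ?_)
        apply mul_le_mul_of_nonneg_right _ (Real.exp_pos _).le
        rw [hq]; simp only [eval_smul, eval_mul, eval_add, smul_eq_mul, derivative_mul, eval_sub]
        nlinarith [sq_nonneg ((LagP m).eval y + (derivative (LagP m)).eval y)]
    _ ≤ _ := by
        refine setIntegral_mono_set (pexp_int q 0 le_rfl) ?_ (Set.Ioi_subset_Ioi hx).eventuallyLE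
        exact Filter.Eventually.of_forall fun y => mul_nonneg (hqn y) (Real.exp_pos _).le

lemma lagE0_hasDeriv (m : ℕ) (x : ℝ) : HasDerivAt (lagE 0 m)
    (((derivative (LagP m)).eval x - (LagP m).eval x / 2) * Real.exp (-(x/2))) x := by
  have e : lagE 0 m = fun x => (LagP m).eval x * Real.exp (-(x/2)) := by
    funext x; rw [lagE, LagP_eval]
  rw [e]
  have := ((LagP m).hasDerivAt x).mul (((hasDerivAt_id x).div_const 2).neg.exp)
  refine this.congr_deriv ?_
  simp; ring

lemma lagE_contDiff (d m : ℕ) : ContDiff ℝ (⊤ : ℕ∞) (lagE d m) := by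
  unfold lagE laguerreL
  fun_prop

lemma lagE0_var (m : ℕ) (c : ℝ) (hc : 0 ≤ c) :
    ∫ μ in (1/4 : ℝ)..8, |c * deriv (lagE 0 m) (c * μ)| ≤ 20 * Real.sqrt (m + 1) := by
  set S := Real.sqrt (m + 1) with hS
  have hm : (0:ℝ) < m + 1 := by positivity
  have hS0 : 0 < S := Real.sqrt_pos.2 hm
  have hSS : S * S = m + 1 := Real.mul_self_sqrt hm.le
  rcases eq_or_lt_of_le hc with rfl | hc0
  · simp; positivity
  set q : ℝ[X] := (2:ℝ) • (X * (derivative (LagP m) * derivative (LagP m))) + (1/2 : ℝ) • (X * (LagP m * LagP m)) with hq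
  have hLq : Lam q ≤ 4 * (m + 1) := by
    rw [hq, map_add, map_smul, map_smul, LagP_xd]
    have := LagP_x m
    simp only [smul_eq_mul]; linarith
  have hq0 : ∀ x : ℝ, 0 ≤ x → 0 ≤ q.eval x := by
    intro x hx
    rw [hq]; simp only [eval_smul, eval_mul, eval_X, eval_add, smul_eq_mul]
    have := mul_self_nonneg ((LagP m).eval x)
    have := mul_self_nonneg ((derivative (LagP m)).eval x)
    positivity
  have hpt : ∀ μ ∈ Set.Icc (1/4 : ℝ) 8, |c * deriv (lagE 0 m) (c * μ)| ≤
      (2 * S)⁻¹ * (c * (q.eval (c * μ) * Real.exp (-(c * μ)))) + 2 * S := by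
    intro μ hμ
    have hμ0 : 0 < μ := by linarith [hμ.1]
    rw [(lagE0_hasDeriv m (c * μ)).deriv]
    set A := (derivative (LagP m)).eval (c * μ)
    set B := (LagP m).eval (c * μ)
    have hx : Real.exp (-(c * μ)) = Real.exp (-(c * μ / 2)) ^ 2 := by
      rw [← Real.exp_nat_mul]; congr 1; push_cast; ring
    set y := Real.exp (-(c * μ / 2))
    have hqe : q.eval (c * μ) = c * μ * (2 * A ^ 2 + B ^ 2 / 2) := by
      rw [hq]; simp only [eval_smul, eval_mul, eval_X, eval_add, smul_eq_mul]; ring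
    rw [hqe, hx]
    set w := c * ((A - B / 2) * y)
    have h1 : |w| ≤ (2 * S)⁻¹ * (μ * w ^ 2) + 2 * S := by
      have h2 : (2 * S) * |w| ≤ μ * w ^ 2 + 4 * S ^ 2 := by
        have : |w| ^ 2 = w ^ 2 := sq_abs w
        have h3 : (1/4) * w^2 ≤ μ * w ^ 2 := mul_le_mul_of_nonneg_right hμ.1 (sq_nonneg w)
        nlinarith [sq_nonneg (|w| / 2 - 2 * S)]
      have h4 : |w| ≤ (μ * w ^ 2 + 4 * S ^ 2) / (2 * S) := by
        rw [le_div_iff₀ (by positivity)]; linarith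
      refine h4.trans (le_of_eq ?_)
      field_simp
      try ring
    refine h1.trans ?_
    have : μ * w ^ 2 ≤ c * (c * μ * (2 * A ^ 2 + B ^ 2 / 2) * y ^ 2) := by
      have e : c * (c * μ * (2 * A ^ 2 + B ^ 2 / 2) * y ^ 2) - μ * w ^ 2
        = μ * c ^ 2 * y ^ 2 * (A + B / 2) ^ 2 := by simp only [w]; ring
      have : 0 ≤ μ * c ^ 2 * y ^ 2 * (A + B / 2) ^ 2 := by positivity
      linarith
    have hi : 0 ≤ (2 * S)⁻¹ := by positivity
    linarith [mul_le_mul_of_nonneg_left this hi]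
  have hcd : Continuous (deriv (lagE 0 m)) := (lagE_contDiff 0 m).continuous_deriv (by simp)
  have hqc : Continuous (fun μ : ℝ => c * (q.eval (c * μ) * Real.exp (-(c * μ)))) := by fun_prop
  have hmain : ∫ μ in (1/4 : ℝ)..8, c * (q.eval (c * μ) * Real.exp (-(c * μ))) ≤ 4 * (m + 1) := by
    rw [intervalIntegral.integral_const_mul, ← smul_eq_mul,
      intervalIntegral.smul_integral_comp_mul_left (fun x => q.eval x * Real.exp (-x)) c]
    rw [intervalIntegral.integral_of_le (by linarith)]
    refine le_trans ?_ hLq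
    rw [Lam_apply]
    refine setIntegral_mono_set (pexp_int q 0 le_rfl) ?_ ?_
    · filter_upwards [ae_restrict_mem measurableSet_Ioi] with x hx
      exact mul_nonneg (hq0 x (le_of_lt hx)) (Real.exp_pos _).le
    · apply HasSubset.Subset.eventuallyLE
      intro x hx
      have : 0 < c * (1/4) := by positivity
      exact this.trans hx.1
  calc _ ≤ ∫ μ in (1/4 : ℝ)..8, ((2 * S)⁻¹ * (c * (q.eval (c * μ) * Real.exp (-(c * μ)))) + 2 * S) := by
        apply intervalIntegral.integral_mono_on (by norm_num) _ _ hpt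
        · apply Continuous.intervalIntegrable; fun_prop
        · apply Continuous.intervalIntegrable; fun_prop
    _ = (2 * S)⁻¹ * (∫ μ in (1/4 : ℝ)..8, c * (q.eval (c * μ) * Real.exp (-(c * μ)))) + (8 - 1/4) * (2 * S) := by
        rw [intervalIntegral.integral_add, intervalIntegral.integral_const_mul, intervalIntegral.integral_const, smul_eq_mul]
        · apply Continuous.intervalIntegrable; fun_prop
        · apply Continuous.intervalIntegrable; fun_prop
    _ ≤ (2 * S)⁻¹ * (4 * (S * S)) + (8 - 1/4) * (2 * S) := by
        rw [hSS]; gcongr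
    _ ≤ 20 * S := by
        have : (2 * S)⁻¹ * (4 * (S * S)) = 2 * S := by field_simp; try norm_num
        rw [this]; linarith

lemma laguerre_rec (d m : ℕ) (x : ℝ) :
    laguerreL (d+1) (m+1) x = laguerreL (d+1) m x + laguerreL d (m+1) x := by
  unfold laguerreL
  rw [Finset.sum_range_succ (n := m+1), Finset.sum_range_succ (n := m+1), ← add_assoc (∑ k ∈ _, _),
    ← Finset.sum_add_distrib]
  congr 1
  · apply Finset.sum_congr rfl
    intro k hk
    have hk' : k ≤ m := by simpa [Nat.lt_succ_iff] using hk
    have e : m + 1 - k = (m - k) + 1 := by omega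
    have e2 : m + 1 + (d + 1) = (m + (d + 1)) + 1 := by omega
    have e3 : m + 1 + d = m + (d + 1) := by omega
    rw [e, e2, e3, Nat.choose_succ_succ]
    push_cast; ring
  · simp

lemma laguerre_sum (d m : ℕ) (x : ℝ) :
    laguerreL (d+1) m x = ∑ k ∈ Finset.range (m+1), laguerreL d k x := by
  induction m with
  | zero => simp [laguerreL]
  | succ m ih => rw [Finset.sum_range_succ, ← ih, laguerre_rec]

lemma lagE_sum (d m : ℕ) : lagE (d+1) m = fun x => ∑ k ∈ Finset.range (m+1), lagE d k x := by
  funext x; simp only [lagE]; rw [laguerre_sum, Finset.sum_mul]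

lemma sum_bd (d m : ℕ) : ∑ k ∈ Finset.range (m+1), 20 * ((k:ℝ)+1)^d * Real.sqrt (k+1)
    ≤ 20 * ((m:ℝ)+1)^(d+1) * Real.sqrt (m+1) := by
  have : ∀ k ∈ Finset.range (m+1), 20 * ((k:ℝ)+1)^d * Real.sqrt (k+1) ≤ 20 * ((m:ℝ)+1)^d * Real.sqrt (m+1) := by
    intro k hk
    have hk' : (k:ℝ) ≤ m := by
      have : k ≤ m := by simpa [Nat.lt_succ_iff] using hk
      exact_mod_cast this
    gcongr
  refine (Finset.sum_le_sum this).trans (le_of_eq ?_)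
  simp; ring

lemma lagE_sup (d m : ℕ) (x : ℝ) (hx : 0 ≤ x) :
    |lagE d m x| ≤ 20 * ((m:ℝ)+1)^d * Real.sqrt (m+1) := by
  induction d generalizing m with
  | zero =>
    refine (lagE0_sup m x hx).trans ?_
    rw [pow_zero, mul_one]
    apply Real.sqrt_le_iff.2
    refine ⟨by positivity, ?_⟩
    rw [mul_pow, Real.sq_sqrt (by positivity)]
    have : (0:ℝ) ≤ m := by positivity
    linarith
  | succ d ih =>
    rw [lagE_sum]
    exact (Finset.abs_sum_le_sum_abs _ _).trans ((Finset.sum_le_sum fun k _ => ih k).trans (sum_bd d m))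

lemma lagE_var (d m : ℕ) (c : ℝ) (hc : 0 ≤ c) :
    ∫ μ in (1/4 : ℝ)..8, |c * deriv (lagE d m) (c * μ)| ≤ 20 * ((m:ℝ)+1)^d * Real.sqrt (m+1) := by
  induction d generalizing m with
  | zero => simpa using lagE0_var m c hc
  | succ d ih =>
    have hcd : ∀ d m, Continuous (deriv (lagE d m)) :=
      fun d m => (lagE_contDiff d m).continuous_deriv (by simp)
    have hd : ∀ x, deriv (lagE (d+1) m) x = ∑ k ∈ Finset.range (m+1), deriv (lagE d k) x := by
      intro x
      rw [lagE_sum]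
      exact deriv_fun_sum (fun k _ => (lagE_contDiff d k).differentiable (by simp) x)
    have hi : ∀ d m, IntervalIntegrable (fun μ => |c * deriv (lagE d m) (c * μ)|) volume (1/4) 8 := by
      intro d m
      have := hcd d m
      apply Continuous.intervalIntegrable; fun_prop
    calc _ ≤ ∫ μ in (1/4 : ℝ)..8, ∑ k ∈ Finset.range (m+1), |c * deriv (lagE d k) (c * μ)| := by
          apply intervalIntegral.integral_mono_on (by norm_num) (hi _ _)
          · have := fun k => hcd d k
            apply Continuous.intervalIntegrable; fun_prop
          · intro μ _
            rw [hd, Finset.mul_sum]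
            exact Finset.abs_sum_le_sum_abs _ _
      _ = ∑ k ∈ Finset.range (m+1), ∫ μ in (1/4 : ℝ)..8, |c * deriv (lagE d k) (c * μ)| :=
          intervalIntegral.integral_finsetSum (fun k _ => hi d k)
      _ ≤ _ := (Finset.sum_le_sum fun k _ => ih k).trans (sum_bd d m)

lemma amp_bound (n : ℕ) (R : ℝ → ℝ) (hR : ContDiff ℝ (⊤ : ℕ∞) R) : ∃ K : ℝ, 0 < K ∧
    ∀ (d m : ℕ) (c : ℝ), 0 ≤ c →
    ∫ μ in (1/4 : ℝ)..8, |deriv (fun μ => R μ * μ ^ n * lagE d m (c * μ)) μ|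
      ≤ K * (((m:ℝ)+1)^d * Real.sqrt (m+1)) := by
  set Q : ℝ → ℝ := fun μ => R μ * μ ^ n with hQ
  have hQd : ContDiff ℝ (⊤ : ℕ∞) Q := by fun_prop
  have hQc : Continuous Q := hQd.continuous
  have hQ'c : Continuous (deriv Q) := hQd.continuous_deriv (by simp)
  obtain ⟨K1, hK1⟩ := (isCompact_Icc (a := (1/4:ℝ)) (b := 8)).exists_bound_of_continuousOn hQc.continuousOn
  obtain ⟨K2, hK2⟩ := (isCompact_Icc (a := (1/4:ℝ)) (b := 8)).exists_bound_of_continuousOn hQ'c.continuousOn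
  have hK10 : 0 ≤ K1 := (norm_nonneg _).trans (hK1 1 (by norm_num))
  have hK20 : 0 ≤ K2 := (norm_nonneg _).trans (hK2 1 (by norm_num))
  refine ⟨20 * (8 * K2 + K1) + 1, by positivity, fun d m c hc => ?_⟩
  set B := ((m:ℝ)+1)^d * Real.sqrt (m+1) with hB
  have hB0 : 0 ≤ B := by positivity
  have hcd : Continuous (deriv (lagE d m)) := (lagE_contDiff d m).continuous_deriv (by simp)
  have hder : ∀ μ, HasDerivAt (fun μ => R μ * μ ^ n * lagE d m (c * μ))
      (deriv Q μ * lagE d m (c * μ) + Q μ * (c * deriv (lagE d m) (c * μ))) μ := by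
    intro μ
    have h1 : HasDerivAt Q (deriv Q μ) μ := (hQd.differentiable (by simp) μ).hasDerivAt
    have h2 : HasDerivAt (lagE d m) (deriv (lagE d m) (c * μ)) (c * μ) :=
      ((lagE_contDiff d m).differentiable (by simp) _).hasDerivAt
    have h3 := h2.comp μ ((hasDerivAt_id μ).const_mul c)
    refine (h1.mul h3).congr_deriv ?_
    simp only [Function.comp, mul_one]; ring
  have hlc : Continuous (lagE d m) := (lagE_contDiff d m).continuous
  calc _ ≤ ∫ μ in (1/4 : ℝ)..8, (K2 * (20 * B) + K1 * |c * deriv (lagE d m) (c * μ)|) := by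
        simp only [fun μ => (hder μ).deriv]
        apply intervalIntegral.integral_mono_on (by norm_num)
        · apply Continuous.intervalIntegrable; fun_prop
        · apply Continuous.intervalIntegrable; fun_prop
        · intro μ hμ
          refine (abs_add_le _ _).trans ?_
          rw [abs_mul, abs_mul]
          have h1 : |deriv Q μ| ≤ K2 := hK2 μ hμ
          have h2 : |Q μ| ≤ K1 := hK1 μ hμ
          have h3 := lagE_sup d m (c * μ) (mul_nonneg hc (by linarith [hμ.1]))
          rw [mul_assoc, ← hB] at h3
          gcongr
    _ = (8 - 1/4) * (K2 * (20 * B)) + K1 * ∫ μ in (1/4 : ℝ)..8, |c * deriv (lagE d m) (c * μ)| := by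
        rw [intervalIntegral.integral_add, intervalIntegral.integral_const_mul K1, intervalIntegral.integral_const, smul_eq_mul]
        · apply Continuous.intervalIntegrable; fun_prop
        · apply Continuous.intervalIntegrable; fun_prop
    _ ≤ (8 - 1/4) * (K2 * (20 * B)) + K1 * (20 * B) := by
        have := lagE_var d m c hc
        rw [mul_assoc, ← hB] at this
        gcongr
    _ ≤ _ := by nlinarith [mul_nonneg hK20 hB0]

end LaguerrePart

lemma half_bound (n : ℕ) (α : ℝ) (hα0 : 0 < α) (hα1 : α < 1) (R : ℝ → ℝ)
    (hRsm : ContDiff ℝ (⊤ : ℕ∞) R) (hRsupp : ∀ τ, R τ ≠ 0 → 1 / 2 ≤ |τ| ∧ |τ| ≤ 4) :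
    ∃ K : ℝ, 0 < K ∧ ∀ (d m : ℕ) (c T σ : ℝ), 0 ≤ c → T ≠ 0 →
    ‖∫ μ in Set.Ioi (0:ℝ), Complex.exp (Complex.I * ((T * μ ^ α - σ * μ : ℝ) : ℂ)) *
      ((R μ * μ ^ n * lagE d m (c * μ) : ℝ) : ℂ)‖ ≤
      K * |T| ^ (-(1/2) : ℝ) * (((m:ℝ)+1)^d * Real.sqrt (m+1)) := by
  obtain ⟨K1, hK1, h1⟩ := vdc_phase α hα0 hα1
  obtain ⟨K2, hK2, h2⟩ := amp_bound n R hRsm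
  refine ⟨K1 * K2, by positivity, fun d m c T σ hc hT => ?_⟩
  have hz : ∀ μ, 0 < μ → μ ∉ Set.Ioc (1/4:ℝ) 8 → R μ = 0 := by
    intro μ h0 h
    by_contra hne
    obtain ⟨ha, hb⟩ := hRsupp μ hne
    rw [abs_of_pos h0] at ha hb
    exact h ⟨by linarith, by linarith⟩
  have hs : ∫ μ in Set.Ioi (0:ℝ), Complex.exp (Complex.I * ((T * μ ^ α - σ * μ : ℝ) : ℂ)) *
      ((R μ * μ ^ n * lagE d m (c * μ) : ℝ) : ℂ) =
      ∫ μ in (1/4:ℝ)..8, Complex.exp (Complex.I * ((T * μ ^ α - σ * μ : ℝ) : ℂ)) *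
      ((R μ * μ ^ n * lagE d m (c * μ) : ℝ) : ℂ) := by
    rw [intervalIntegral.integral_of_le (by norm_num)]
    refine setIntegral_eq_of_subset_of_forall_sdiff_eq_zero measurableSet_Ioi
      (fun x hx => lt_trans (by norm_num) hx.1) (fun x hx => ?_)
    rw [hz x hx.1 hx.2]; simp
  have hlc := lagE_contDiff d m
  have hac : ContDiff ℝ (⊤ : ℕ∞) (fun μ => R μ * μ ^ n * lagE d m (c * μ)) := by fun_prop
  have hpc : Continuous (fun μ : ℝ => μ ^ α) := Real.continuous_rpow_const hα0.le
  have := vdc_amp (fun μ => Complex.exp (Complex.I * ((T * μ ^ α - σ * μ : ℝ) : ℂ)))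
    (fun μ => R μ * μ ^ n * lagE d m (c * μ)) (deriv (fun μ => R μ * μ ^ n * lagE d m (c * μ)))
    (1/4) 8 (K1 * |T| ^ (-(1/2) : ℝ)) (by norm_num) (by fun_prop)
    (fun x _ => (hac.differentiable (by simp) x).hasDerivAt)
    (hac.continuous_deriv (by simp)).continuousOn
    (by
      have : R 8 = 0 := by
        by_contra hne
        obtain ⟨ha, hb⟩ := hRsupp 8 hne
        norm_num at hb
      simp [this])
    (h1 T σ hT)
  rw [hs]
  refine this.trans ?_
  have h3 := mul_le_mul_of_nonneg_left (h2 d m c hc) (by positivity : 0 ≤ K1 * |T| ^ (-(1/2) : ℝ))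
  refine h3.trans (le_of_eq (by ring))

lemma full_bound (G : ℝ → ℂ) (B : ℝ) (hB : 0 ≤ B) (h1 : ‖∫ μ in Set.Ioi (0:ℝ), G μ‖ ≤ B)
    (h2 : ‖∫ μ in Set.Ioi (0:ℝ), G (-μ)‖ ≤ B) : ‖∫ μ, G μ‖ ≤ 2 * B := by
  by_cases hG : Integrable G
  · rw [← intervalIntegral.integral_Iic_add_Ioi (b := 0) hG.integrableOn hG.integrableOn]
    rw [integral_comp_neg_Ioi, neg_zero] at h2
    exact (norm_add_le _ _).trans (by linarith)
  · rw [integral_undef hG]; simp [hB]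

lemma Fterm_eq (n : ℕ) (R : ℝ → ℝ) (α : ℝ) (j : ℤ) (t : ℝ) (z : Fin n → ℂ) (s : ℝ) (m : ℕ)
    (P A : ℝ) (hP : P = (2:ℝ) ^ (2 * j)) (hA : A = 2 * (m:ℝ) + n) (hA0 : 0 < A) :
    Fterm n R (fun r => r ^ α) j t z s m = (((P / A) ^ (n + 1) : ℝ) : ℂ) *
      ∫ μ : ℝ, Complex.exp (Complex.I * ((t * (4 * P) ^ α * |μ| ^ α - (P / A * s) * μ : ℝ) : ℂ)) *
        ((R |μ| * |μ| ^ n * lagE (n - 1) m ((2 * (P / A) * hnormSq z) * |μ|) : ℝ) : ℂ) := by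
  have hP0 : 0 < P := by rw [hP]; positivity
  have hPi : (2:ℝ) ^ (-(2:ℤ) * j) = P⁻¹ := by
    rw [hP, ← zpow_neg]; congr 1; ring
  set K := P / A with hK
  have hK0 : 0 < K := by positivity
  unfold Fterm
  rw [hPi]
  set g : ℝ → ℂ := fun lam => Complex.exp (-(Complex.I * lam * s)) *
      Complex.exp (Complex.I * t * (((4 * (2 * (m : ℝ) + n) * |lam|) ^ α : ℝ) : ℂ)) *
      ((R (P⁻¹ * (2 * (m : ℝ) + n) * |lam|) *
        laguerreL (n - 1) m (2 * |lam| * hnormSq z) *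
        Real.exp (-(|lam| * hnormSq z)) * |lam| ^ n : ℝ) : ℂ) with hg
  have hsub := Measure.integral_comp_mul_left g K
  rw [abs_of_pos (inv_pos.2 hK0)] at hsub
  have h2 : ∫ lam, g lam = (K : ℂ) * ∫ μ, g (K * μ) := by
    rw [hsub, Complex.real_smul]
    have : (K : ℂ) ≠ 0 := by exact_mod_cast hK0.ne'
    push_cast
    field_simp
  change ∫ lam, g lam = _
  rw [h2, pow_succ, Complex.ofReal_mul, mul_comm (((K ^ n : ℝ)) : ℂ), mul_assoc, ← integral_const_mul ((K ^ n : ℝ) : ℂ)]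
  congr 2
  funext μ
  simp only [hg]
  have e1 : |K * μ| = K * |μ| := by rw [abs_mul, abs_of_pos hK0]
  have e2 : 4 * (2 * (m : ℝ) + n) * (K * |μ|) = 4 * P * |μ| := by
    rw [← hA, hK]; field_simp
  have e3 : P⁻¹ * (2 * (m : ℝ) + n) * (K * |μ|) = |μ| := by
    rw [← hA, hK]; field_simp
  rw [e1, e2, e3, Real.mul_rpow (by positivity) (abs_nonneg _), ← Complex.exp_add, lagE]
  have e4 : 2 * (K * |μ|) * hnormSq z = 2 * K * hnormSq z * |μ| := by ring
  have e5 : 2 * K * hnormSq z * |μ| / 2 = K * |μ| * hnormSq z := by ring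
  rw [e4, e5]
  have e6 : -(Complex.I * ((K * μ : ℝ) : ℂ) * s) + Complex.I * t * (((4 * P) ^ α * |μ| ^ α : ℝ) : ℂ)
     = Complex.I * ((t * (4 * P) ^ α * |μ| ^ α - (K * s) * μ : ℝ) : ℂ) := by
    push_cast; ring
  rw [e6, mul_pow]
  push_cast
  ring

lemma Fterm_bound (n : ℕ) (hn : 1 ≤ n) (α : ℝ) (hα0 : 0 < α) (hα1 : α < 1) (R : ℝ → ℝ)
    (hRsm : ContDiff ℝ (⊤ : ℕ∞) R) (hRsupp : ∀ τ, R τ ≠ 0 → 1 / 2 ≤ |τ| ∧ |τ| ≤ 4) :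
    ∃ K : ℝ, 0 < K ∧ ∀ (j : ℤ) (t : ℝ), t ≠ 0 → ∀ (z : Fin n → ℂ) (s : ℝ) (m : ℕ),
    ‖Fterm n R (fun r => r ^ α) j t z s m‖ ≤
      K * |t| ^ (-(1 / 2) : ℝ) * (2 : ℝ) ^ ((j : ℝ) * ((2 * (n : ℝ) + 2) - α)) *
        (1 / ((m:ℝ)+1) ^ (3/2 : ℝ)) := by
  obtain ⟨K, hK, h⟩ := half_bound n α hα0 hα1 R hRsm hRsupp
  refine ⟨2 * K, by positivity, fun j t ht z s m => ?_⟩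
  set A : ℝ := 2 * (m:ℝ) + n with hA
  have hn' : (1:ℝ) ≤ n := by exact_mod_cast hn
  have hm0 : (0:ℝ) ≤ m := by positivity
  have hAm : (m:ℝ) + 1 ≤ A := by rw [hA]; linarith
  have hA0 : 0 < A := by linarith
  set P : ℝ := (2:ℝ) ^ (2 * j) with hP
  have hP0 : 0 < P := by positivity
  rw [Fterm_eq n R α j t z s m P A hP hA hA0]
  set T := t * (4 * P) ^ α with hT
  have hT0 : T ≠ 0 := mul_ne_zero ht (by positivity)
  have hZ : 0 ≤ hnormSq z := Finset.sum_nonneg fun i _ => Complex.normSq_nonneg _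
  have hc : 0 ≤ 2 * (P / A) * hnormSq z := by positivity
  set B := K * |T| ^ (-(1/2) : ℝ) * (((m:ℝ)+1)^(n-1) * Real.sqrt (m+1)) with hB
  have hB0 : 0 ≤ B := by positivity
  have hfull := full_bound (fun μ => Complex.exp (Complex.I * ((T * |μ| ^ α - (P / A * s) * μ : ℝ) : ℂ)) *
        ((R |μ| * |μ| ^ n * lagE (n - 1) m ((2 * (P / A) * hnormSq z) * |μ|) : ℝ) : ℂ)) B hB0
    (by
      refine le_trans (le_of_eq ?_) (h (n-1) m (2 * (P / A) * hnormSq z) T (P / A * s) hc hT0)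
      congr 1
      refine setIntegral_congr_fun measurableSet_Ioi (fun μ hμ => ?_)
      simp only [abs_of_pos (Set.mem_Ioi.1 hμ)])
    (by
      refine le_trans (le_of_eq ?_) (h (n-1) m (2 * (P / A) * hnormSq z) T (-(P / A * s)) hc hT0)
      congr 1
      refine setIntegral_congr_fun measurableSet_Ioi (fun μ hμ => ?_)
      simp only [abs_neg, abs_of_pos (Set.mem_Ioi.1 hμ), mul_neg, neg_mul])
  rw [norm_mul, Complex.norm_real, Real.norm_of_nonneg (by positivity)]
  refine (mul_le_mul_of_nonneg_left hfull (by positivity)).trans ?_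
  have hPr : P = (2:ℝ) ^ (2 * (j:ℝ)) := by
    rw [hP, ← Real.rpow_intCast]; push_cast; rfl
  have hTb : |T| ^ (-(1/2) : ℝ) ≤ |t| ^ (-(1/2) : ℝ) * (2:ℝ) ^ (-((j:ℝ) * α)) := by
    rw [hT, abs_mul, Real.mul_rpow (abs_nonneg _) (abs_nonneg _)]
    apply mul_le_mul_of_nonneg_left _ (by positivity)
    rw [abs_of_pos (by positivity), ← Real.rpow_mul (by positivity), Real.mul_rpow (by norm_num) hP0.le,
      hPr, ← Real.rpow_mul (by norm_num)]
    have h4 : (4:ℝ) ^ (α * -(1/2)) ≤ 1 := Real.rpow_le_one_of_one_le_of_nonpos (by norm_num) (by linarith)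
    have e : 2 * (j:ℝ) * (α * -(1/2)) = -((j:ℝ) * α) := by ring
    rw [e]
    exact mul_le_of_le_one_left (by positivity) h4
  have hPP : P ^ (n+1) = (2:ℝ) ^ ((j:ℝ) * (2 * n + 2)) := by
    rw [hPr, ← Real.rpow_natCast, ← Real.rpow_mul (by norm_num)]; congr 1; push_cast; ring
  have h2 : (2 : ℝ) ^ ((j : ℝ) * ((2 * (n : ℝ) + 2) - α)) = P ^ (n+1) * (2:ℝ) ^ (-((j:ℝ) * α)) := by
    rw [hPP, ← Real.rpow_add (by norm_num)]; congr 1; ring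
  have hPA : (P / A) ^ (n+1) ≤ P ^ (n+1) / ((m:ℝ)+1) ^ (n+1) := by
    rw [div_pow]; gcongr
  have hmm : 1 / ((m:ℝ)+1) ^ (n+1) * (((m:ℝ)+1)^(n-1) * Real.sqrt (m+1)) = 1 / ((m:ℝ)+1) ^ (3/2 : ℝ) := by
    have hm1 : (0:ℝ) < m + 1 := by positivity
    have e : n + 1 = (n - 1) + 2 := by omega
    have e2 : ((m:ℝ)+1) ^ (3/2 : ℝ) * Real.sqrt (m+1) = ((m:ℝ)+1)^2 := by
      rw [Real.sqrt_eq_rpow, ← Real.rpow_add hm1, ← Real.rpow_natCast]; norm_num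
    rw [e, pow_add, ← e2]
    have : 0 < Real.sqrt ((m:ℝ)+1) := Real.sqrt_pos.2 hm1
    field_simp
  rw [h2, ← hmm]
  calc (P / A) ^ (n+1) * (2 * B) ≤ P ^ (n+1) / ((m:ℝ)+1) ^ (n+1) *
        (2 * (K * (|t| ^ (-(1/2) : ℝ) * (2:ℝ) ^ (-((j:ℝ) * α))) * (((m:ℝ)+1)^(n-1) * Real.sqrt (m+1)))) := by
        rw [hB]; gcongr
    _ = _ := by ring

/-- `L¹ → L^∞` dispersive estimate for the frequency-localized fractional Schrödinger
propagator on the Heisenberg group (`φ(r) = r^α`, `0 < α < 1`):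
`sup_w |(f * F_j^φ(t,·))(w)| ≤ C |t|^{-1/2} 2^{j(N-α)} ‖f‖_{L¹}`, `N = 2n+2`. -/
theorem statement14 (n : ℕ) (hn : 1 ≤ n) (α : ℝ) (hα0 : 0 < α) (hα1 : α < 1)
    (R : ℝ → ℝ) (hRsm : ContDiff ℝ (⊤ : ℕ∞) R) (hRcs : HasCompactSupport R)
    (hRev : ∀ τ, R (-τ) = R τ) (hRpos : ∀ τ, 0 ≤ R τ)
    (hRsupp : ∀ τ, R τ ≠ 0 → 1 / 2 ≤ |τ| ∧ |τ| ≤ 4)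
    (hRsum : ∀ τ : ℝ, τ ≠ 0 → HasSum (fun j : ℤ => R ((2 : ℝ) ^ (-(2 : ℤ) * j) * τ)) 1) :
    ∃ C : ℝ, 0 < C ∧ ∀ f : (Fin n → ℂ) × ℝ → ℂ, Integrable f →
      ∀ (j : ℤ) (t : ℝ), t ≠ 0 → ∀ w : (Fin n → ℂ) × ℝ,
      ‖∫ v : (Fin n → ℂ) × ℝ,
          f (hMul w (hInv v)) * Fkernel n R (fun r => r ^ α) j t v.1 v.2‖ ≤
        C * |t| ^ (-(1 / 2) : ℝ) * (2 : ℝ) ^ ((j : ℝ) * ((2 * (n : ℝ) + 2) - α)) *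
          ∫ v : (Fin n → ℂ) × ℝ, ‖f v‖ := by
  obtain ⟨K, hK, h⟩ := Fterm_bound n hn α hα0 hα1 R hRsm hRsupp
  have hsum : Summable (fun m : ℕ => 1 / ((m:ℝ)+1) ^ (3/2 : ℝ)) := by
    have h1 := (summable_nat_add_iff 1).2 (Real.summable_one_div_nat_rpow.2 (by norm_num : (1:ℝ) < 3/2))
    simpa using h1
  set c : ℝ := (2 : ℝ) ^ (n - 1) / Real.pi ^ (n + 1) with hc
  have hc0 : 0 < c := by have := Real.pi_pos; positivity
  have hS0 : 0 ≤ ∑' m : ℕ, 1 / ((m:ℝ)+1) ^ (3/2 : ℝ) := tsum_nonneg fun m => by positivity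
  refine ⟨c * K * ((∑' m : ℕ, 1 / ((m:ℝ)+1) ^ (3/2 : ℝ)) + 1), by positivity, fun f hf j t ht w => ?_⟩
  refine conv_bound f _ hf _ (fun v => ?_) w
  have hT : ‖∑' m : ℕ, Fterm n R (fun r => r ^ α) j t v.1 v.2 m‖ ≤
      K * |t| ^ (-(1 / 2) : ℝ) * (2 : ℝ) ^ ((j : ℝ) * ((2 * (n : ℝ) + 2) - α)) *
        ∑' m : ℕ, 1 / ((m:ℝ)+1) ^ (3/2 : ℝ) :=
    tsum_of_norm_bounded (hsum.hasSum.mul_left _) (fun m => h j t ht v.1 v.2 m)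
  rw [Fkernel, norm_mul, ← hc, Complex.norm_real, Real.norm_of_nonneg hc0.le]
  refine (mul_le_mul_of_nonneg_left hT hc0.le).trans ?_
  have hX : 0 ≤ c * K * |t| ^ (-(1 / 2) : ℝ) * (2 : ℝ) ^ ((j : ℝ) * ((2 * (n : ℝ) + 2) - α)) := by
    positivity
  linarith
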